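/- Let p ≥ 3 be an integer, and let T be an invertible contraction on a Banach space whose spectrum Sp T is contained in the perfect symmetric set E_{1/p} ⊆ Γ of constant ratio 1/p. If limsup_{n→∞} (log⁺‖T^{−n}‖)/n^α < +∞ for some α < (log p − log 2)/(2 log p − log 2), then sup_{n≥1} ‖T^{−n}‖ < +∞. -/

import Mathlib

noncomputable section

/-- An invertible contraction on a (complex) Banach space. -/
structure BanachContraction where
  X : Type
  [grp : NormedAddCommGroup X]
  [mod : NormedSpace ℂ X]
  [cpl : CompleteSpace X]
  T : X →L[ℂ] X
  Tinv : X →L[ℂ] X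
  norm_le : ‖T‖ ≤ 1
  mul_inv : T * Tinv = 1
  inv_mul : Tinv * T = 1

attribute [instance] BanachContraction.grp BanachContraction.mod BanachContraction.cpl

open Complex MeasureTheory Metric Set Filter

/-- The `n`-th Taylor coefficient of `f` at `0`, i.e. `f⁽ⁿ⁾(0)/n!`. -/
def taylorCoeff (f : ℂ → ℂ) (n : ℕ) : ℂ := iteratedDeriv n f 0 / (n.factorial : ℂ)

/-- `A⁺`, the algebra of absolutely convergent Taylor series: functions which, on the
closed unit disk, are sums of a power series with absolutely summable coefficients. -/
def APlus : Set (ℂ → ℂ) :=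
  {f | ∃ a : ℕ → ℂ, Summable (fun n => ‖a n‖) ∧
    ∀ z ∈ Metric.closedBall (0 : ℂ) 1, HasSum (fun n => a n * z ^ n) (f z)}

/-- The norm `‖f‖₁ = ∑ₙ |f⁽ⁿ⁾(0)/n!|` on `A⁺`. -/
def APlusNorm (f : ℂ → ℂ) : ℝ := ∑' n : ℕ, ‖taylorCoeff f n‖

/-- The `n`-th Fourier coefficient of (the boundary values of) `f` on the unit circle. -/
def fcoeff (f : ℂ → ℂ) (n : ℤ) : ℂ :=
  (1 / (2 * Real.pi)) * ∫ θ in (0:ℝ)..(2 * Real.pi),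
    f (Complex.exp ((θ : ℂ) * Complex.I)) * Complex.exp (-(n : ℂ) * (θ : ℂ) * Complex.I)

/-- The Wiener algebra `A(Γ)` of absolutely convergent Fourier series on the unit circle,
viewed as functions `ℂ → ℂ` (only the values on the unit circle are relevant). -/
def WienerAlg : Set (ℂ → ℂ) :=
  {f | Summable (fun n : ℤ => ‖fcoeff f n‖) ∧
    ∀ z ∈ Metric.sphere (0 : ℂ) 1, HasSum (fun n : ℤ => fcoeff f n * z ^ n) (f z)}

/-- The norm `‖f‖₁ = ∑_{n ∈ ℤ} |f̂(n)|` on `A(Γ)`. -/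
def WienerNorm (f : ℂ → ℂ) : ℝ := ∑' n : ℤ, ‖fcoeff f n‖

/-- `I` is a closed ideal of `A⁺` (closedness w.r.t. the norm `APlusNorm`). -/
def IsClosedIdealAPlus (I : Set (ℂ → ℂ)) : Prop :=
  I ⊆ APlus ∧
  (∀ f ∈ I, ∀ g ∈ I, f + g ∈ I) ∧
  (∀ f ∈ APlus, ∀ g ∈ I, f * g ∈ I) ∧
  (∀ f ∈ APlus, (∀ ε > 0, ∃ g ∈ I, APlusNorm (f - g) < ε) → f ∈ I)

/-- `J` is a closed ideal of the Wiener algebra `A(Γ)`. -/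
def IsClosedIdealW (J : Set (ℂ → ℂ)) : Prop :=
  J ⊆ WienerAlg ∧
  (∀ f ∈ J, ∀ g ∈ J, f + g ∈ J) ∧
  (∀ f ∈ WienerAlg, ∀ g ∈ J, f * g ∈ J) ∧
  (∀ f ∈ WienerAlg, (∀ ε > 0, ∃ g ∈ J, WienerNorm (f - g) < ε) → f ∈ J)

/-- `I^A` : the closed ideal generated by `I` in the Wiener algebra `A(Γ)`. -/
def IdealGenW (I : Set (ℂ → ℂ)) : Set (ℂ → ℂ) := ⋂₀ {J | IsClosedIdealW J ∧ I ⊆ J}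

/-- The hull `h(I)`: common zeros in the closed unit disk of all elements of `I`. -/
def hull (I : Set (ℂ → ℂ)) : Set ℂ :=
  {z ∈ Metric.closedBall (0 : ℂ) 1 | ∀ f ∈ I, f z = 0}

/-- `I ≠ {0}`: `I` contains an element not identically zero on the unit disk. -/
def NontrivialIdeal (I : Set (ℂ → ℂ)) : Prop :=
  ∃ f ∈ I, ∃ z ∈ Metric.ball (0 : ℂ) 1, f z ≠ 0

/-- `H^∞(D)`: bounded holomorphic functions on the open unit disk. -/
def Hinf : Set (ℂ → ℂ) :=
  {f | DifferentiableOn ℂ f (Metric.ball (0 : ℂ) 1) ∧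
    ∃ C : ℝ, ∀ z ∈ Metric.ball (0 : ℂ) 1, ‖f z‖ ≤ C}

/-- An inner function: a bounded-by-one holomorphic function on the unit disk whose
radial limits have modulus `1` at almost every boundary point. -/
def IsInnerFunction (u : ℂ → ℂ) : Prop :=
  DifferentiableOn ℂ u (Metric.ball (0 : ℂ) 1) ∧
  (∀ z ∈ Metric.ball (0 : ℂ) 1, ‖u z‖ ≤ 1) ∧
  ∀ᵐ (θ : ℝ) ∂(MeasureTheory.volume.restrict (Set.Ioc (0 : ℝ) (2 * Real.pi))),
    Filter.Tendsto (fun r : ℝ => ‖u ((r : ℂ) * Complex.exp ((θ : ℂ) * Complex.I))‖)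
      (nhdsWithin 1 (Set.Iio 1)) (nhds 1)

/-- `S` divides (the inner factor of) `f`, i.e. `f ∈ S·H^∞`. -/
def InnerDivides (S f : ℂ → ℂ) : Prop :=
  ∃ g ∈ Hinf, ∀ z ∈ Metric.ball (0 : ℂ) 1, f z = S z * g z

/-- `S` is a greatest common divisor of the inner factors of the nonzero elements of `I`:
`S` is inner, divides every nonzero element of `I`, and every inner function with this
property divides `S`. -/
def IsGcdInner (I : Set (ℂ → ℂ)) (S : ℂ → ℂ) : Prop :=
  IsInnerFunction S ∧
  (∀ f ∈ I, (∃ z ∈ Metric.ball (0 : ℂ) 1, f z ≠ 0) → InnerDivides S f) ∧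
  ∀ S' : ℂ → ℂ, IsInnerFunction S' →
    (∀ f ∈ I, (∃ z ∈ Metric.ball (0 : ℂ) 1, f z ≠ 0) → InnerDivides S' f) →
    InnerDivides S' S

/-- The perfect symmetric set `E_ξ` of constant ratio `ξ` on the unit circle. -/
def Eset (ξ : ℝ) : Set ℂ :=
  {z | ∃ ε : ℕ → ℕ, (∀ k, ε k ≤ 1) ∧
    z = Complex.exp (2 * Real.pi * Complex.I *
      (((1 - ξ) * ∑' k : ℕ, (ε k : ℝ) * ξ ^ k : ℝ) : ℂ))}

/-- A Carleson set: a closed subset of the unit circle with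
`∫_{-π}^{π} log (2 / dist(e^{iθ}, E)) dθ < ∞`. -/
def IsCarleson (E : Set ℂ) : Prop :=
  IsClosed E ∧ E ⊆ Metric.sphere (0 : ℂ) 1 ∧
  MeasureTheory.IntegrableOn
    (fun θ : ℝ => Real.log (2 / Metric.infDist (Complex.exp ((θ : ℂ) * Complex.I)) E))
    (Set.Ioc (-Real.pi) Real.pi)

/-- The division ideal `I(f) = {g ∈ A⁺ : fg ∈ I}`. -/
def Idiv (I : Set (ℂ → ℂ)) (f : ℂ → ℂ) : Set (ℂ → ℂ) := {g ∈ APlus | f * g ∈ I}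

/-- `f` belongs to `A^∞(D)` and vanishes on `E` together with all its derivatives:
`f` is holomorphic on the disk, and each derivative extends continuously to the closed
disk with the extension vanishing on `E`. -/
def VanishAllDeriv (E : Set ℂ) (f : ℂ → ℂ) : Prop :=
  ContinuousOn f (Metric.closedBall (0 : ℂ) 1) ∧
  DifferentiableOn ℂ f (Metric.ball (0 : ℂ) 1) ∧
  (∀ z ∈ E, f z = 0) ∧
  ∀ n : ℕ, ∃ g : ℂ → ℂ, ContinuousOn g (Metric.closedBall (0 : ℂ) 1) ∧
    Set.EqOn g (iteratedDeriv n f) (Metric.ball (0 : ℂ) 1) ∧ ∀ z ∈ E, g z = 0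

/-- `J₀⁺(E)`: the closure in `A⁺` of the set of elements of `A^∞(D)` vanishing on `E`
together with all their derivatives. -/
def J0Plus (E : Set ℂ) : Set (ℂ → ℂ) :=
  {f | f ∈ APlus ∧ ∀ ε > 0, ∃ g ∈ APlus, VanishAllDeriv E g ∧ APlusNorm (f - g) < ε}

/-- `I⁺(E) = {f ∈ A⁺ : f ≡ 0 on E}`. -/
def IPlus (E : Set ℂ) : Set (ℂ → ℂ) := {f ∈ APlus | ∀ z ∈ E, f z = 0}

/-- The pairing of `f ∈ A⁺ ≅ ℓ¹(ℕ)` with an element `c ∈ c₀`. -/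
def pairing (f : ℂ → ℂ) (c : ℕ → ℂ) : ℂ := ∑' n : ℕ, taylorCoeff f n * c n

/-- `S` is dense in `A⁺` for the weak-star topology `σ(ℓ¹, c₀)`. -/
def WStarDense (S : Set (ℂ → ℂ)) : Prop :=
  ∀ f ∈ APlus, ∀ (m : ℕ) (c : Fin m → ℕ → ℂ),
    (∀ i, Filter.Tendsto (c i) Filter.atTop (nhds 0)) →
    ∀ ε > 0, ∃ g ∈ S, ∀ i, ‖pairing f (c i) - pairing g (c i)‖ < ε

/-- `S` is closed in `A⁺` for the weak-star topology `σ(ℓ¹, c₀)`. -/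
def WStarClosed (S : Set (ℂ → ℂ)) : Prop :=
  S ⊆ APlus ∧
  ∀ f ∈ APlus,
    (∀ (m : ℕ) (c : Fin m → ℕ → ℂ),
      (∀ i, Filter.Tendsto (c i) Filter.atTop (nhds 0)) →
      ∀ ε > 0, ∃ g ∈ S, ∀ i, ‖pairing f (c i) - pairing g (c i)‖ < ε) → f ∈ S

/-- A Kronecker set: a compact subset of the unit circle on which every continuous
unimodular function is a uniform limit of characters `z ↦ zⁿ`, `n ∈ ℤ`. -/
def IsKronecker (K : Set ℂ) : Prop :=
  IsCompact K ∧ K ⊆ Metric.sphere (0 : ℂ) 1 ∧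
  ∀ f : ℂ → ℂ, ContinuousOn f K → (∀ z ∈ K, ‖f z‖ = 1) →
    ∀ ε > 0, ∃ n : ℤ, ∀ z ∈ K, ‖f z - z ^ n‖ < ε

/-- A Helson set: a compact subset of the unit circle on which every continuous function
is the restriction of an element of the Wiener algebra. -/
def IsHelson (K : Set ℂ) : Prop :=
  IsCompact K ∧ K ⊆ Metric.sphere (0 : ℂ) 1 ∧
  ∀ f : ℂ → ℂ, ContinuousOn f K → ∃ g ∈ WienerAlg, ∀ z ∈ K, f z = g z

/-- The little Lipschitz class `Λ_α(D)`: disc-algebra functions with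
`|f(e^{it₁}) - f(e^{it₂})| / |t₁-t₂|^α → 0` uniformly as `|t₁-t₂| → 0`. -/
def LittleLip (α : ℝ) (f : ℂ → ℂ) : Prop :=
  ContinuousOn f (Metric.closedBall (0 : ℂ) 1) ∧
  DifferentiableOn ℂ f (Metric.ball (0 : ℂ) 1) ∧
  ∀ ε > 0, ∃ δ > 0, ∀ t₁ t₂ : ℝ, t₁ ≠ t₂ → |t₁ - t₂| < δ →
    ‖f (Complex.exp ((t₁ : ℂ) * Complex.I)) - f (Complex.exp ((t₂ : ℂ) * Complex.I))‖ ≤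
      ε * |t₁ - t₂| ^ α

/-- The perfect part of a set: the union of all its perfect subsets. -/
def perfectPart (C : Set ℂ) : Set ℂ := ⋃₀ {P | Perfect P ∧ P ⊆ C}

/-- A distribution on the unit circle, encoded by its sequence of Fourier coefficients
`μ̂(n) = μ(e^{-int})`, which has polynomial growth. -/
structure CircleDistribution where
  coeff : ℤ → ℂ
  growth : ∃ (C : ℝ) (k : ℕ), ∀ n : ℤ, ‖coeff n‖ ≤ C * (1 + (n.natAbs : ℝ)) ^ k

/-- A smooth `2π`-periodic function (test function on the circle). -/
def PeriodicSmooth (φ : ℝ → ℂ) : Prop :=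
  ContDiff ℝ (⊤ : ℕ∞) φ ∧ ∀ θ : ℝ, φ (θ + 2 * Real.pi) = φ θ

/-- Fourier coefficients of a test function. -/
def testCoeff (φ : ℝ → ℂ) (n : ℤ) : ℂ :=
  (1 / (2 * Real.pi)) * ∫ θ in (0:ℝ)..(2 * Real.pi),
    φ θ * Complex.exp (-(n : ℂ) * (θ : ℂ) * Complex.I)

/-- The action of a distribution on a test function: `μ(φ) = ∑ₙ μ̂(n) φ̂(-n)`. -/
def distAct (μ : CircleDistribution) (φ : ℝ → ℂ) : ℂ := ∑' n : ℤ, μ.coeff n * testCoeff φ (-n)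

/-- The support of a distribution on the circle: the points of the circle having no open
neighbourhood `U` such that `μ` kills every test function supported in `U`. -/
def distSupport (μ : CircleDistribution) : Set ℂ :=
  {z ∈ Metric.sphere (0 : ℂ) 1 | ∀ U : Set ℂ, IsOpen U → z ∈ U →
    ∃ φ : ℝ → ℂ, PeriodicSmooth φ ∧
      (∀ θ : ℝ, Complex.exp ((θ : ℂ) * Complex.I) ∉ U → φ θ = 0) ∧ distAct μ φ ≠ 0}

/-- A set of multiplicity: a closed subset of the circle supporting a nonzero
pseudofunction (distribution whose Fourier coefficients tend to `0` as `|n| → ∞`). -/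
def IsMSet (E : Set ℂ) : Prop :=
  IsClosed E ∧ E ⊆ Metric.sphere (0 : ℂ) 1 ∧
  ∃ μ : CircleDistribution, μ.coeff ≠ 0 ∧ distSupport μ ⊆ E ∧
    Filter.Tendsto μ.coeff Filter.cofinite (nhds 0)

/-- A Dirichlet set: `sup_{z ∈ E} |z^{n_k} - 1| → 0` for some sequence `n_k → ∞`. -/
def IsDirichletSet (E : Set ℂ) : Prop :=
  ∃ n : ℕ → ℕ, Filter.Tendsto n Filter.atTop Filter.atTop ∧
    ∀ ε > 0, ∀ᶠ k in Filter.atTop, ∀ z ∈ E, ‖z ^ (n k) - 1‖ < ε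

section Resolvent

variable {A : Type*} [NormedRing A] [NormedAlgebra ℂ A]

lemma algebraMap_sub_mul_resolvent {a : A} {z : ℂ} (hz : z ∈ resolventSet ℂ a) :
    (algebraMap ℂ A z - a) * resolvent a z = 1 :=
  Ring.mul_inverse_cancel _ hz

lemma resolvent_mul_algebraMap_sub {a : A} {z : ℂ} (hz : z ∈ resolventSet ℂ a) :
    resolvent a z * (algebraMap ℂ A z - a) = 1 :=
  Ring.inverse_mul_cancel _ hz

/-- Outside the closed unit disk, the resolvent of a contraction is bounded by the inverse of
the distance to the unit circle. -/
lemma norm_resolvent_le_of_one_lt_norm {a : A} (h1 : ‖(1 : A)‖ ≤ 1) (ha : ‖a‖ ≤ 1) {z : ℂ}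
    (hz : z ∈ resolventSet ℂ a) (hz1 : 1 < ‖z‖) :
    ‖resolvent a z‖ ≤ 1 / (‖z‖ - 1) := by
  have h := algebraMap_sub_mul_resolvent hz
  rw [sub_mul, ← Algebra.smul_def, sub_eq_iff_eq_add] at h
  have h2 : ‖z‖ * ‖resolvent a z‖ ≤ 1 + ‖resolvent a z‖ := by
    rw [← norm_smul, h]
    refine (norm_add_le _ _).trans (add_le_add h1 ((norm_mul_le _ _).trans ?_))
    exact mul_le_of_le_one_left (norm_nonneg _) ha
  rw [le_div_iff₀ (by linarith)]
  linarith

/-- Finite Neumann expansion of the resolvent of an invertible element at the origin. -/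
lemma resolvent_eq_neg_sum_add {a b : A} (hab : a * b = 1) {z : ℂ}
    (hz : z ∈ resolventSet ℂ a) (n : ℕ) :
    resolvent a z =
      -(∑ i ∈ Finset.range n, z ^ i • b ^ (i + 1)) + z ^ n • (resolvent a z * b ^ n) := by
  have key : (algebraMap ℂ A z - a) * (∑ i ∈ Finset.range n, z ^ i • b ^ (i + 1)) =
      z ^ n • b ^ n - 1 := by
    induction n with
    | zero => simp
    | succ n ih =>
      rw [Finset.sum_range_succ, mul_add, ih, sub_mul, ← Algebra.smul_def, mul_smul_comm,
        pow_succ' b n, ← mul_assoc a, hab, one_mul, smul_smul, ← pow_succ']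
      abel
  have h := congrArg (resolvent a z * ·) key
  simp only [← mul_assoc, resolvent_mul_algebraMap_sub hz, one_mul, mul_sub, mul_one,
    mul_smul_comm] at h
  rw [h]
  abel

/-- A sublinear power is dominated by a linear function up to an explicit constant. -/
lemma mul_rpow_le_linear_add {α D x t : ℝ} (hα0 : 0 < α) (hα1 : α < 1) (hD : 0 < D) (hx : 0 < x)
    (ht : 0 < t) :
    D * t ^ α ≤ t * x / 2 + D * (2 * D / x) ^ (α / (1 - α)) := by
  have hp : 0 < 2 * D / x := by positivity
  rcases le_total (2 * D / x) (t ^ (1 - α)) with h | h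
  · have h3 : 0 ≤ D * (2 * D / x) ^ (α / (1 - α)) := by positivity
    have h4 : t = t ^ (1 - α) * t ^ α := by
      rw [← Real.rpow_add ht]; simp
    have h5 : 2 * D ≤ t ^ (1 - α) * x := by rwa [div_le_iff₀ hx] at h
    have h6 : 0 < t ^ α := by positivity
    have h7 : t * x / 2 = (t ^ (1 - α) * x) * t ^ α / 2 := by
      conv_lhs => rw [h4]
      ring
    rw [h7]
    nlinarith
  · have h3 : 0 ≤ t * x / 2 := by positivity
    have h4 : t ^ α ≤ (2 * D / x) ^ (α / (1 - α)) := by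
      have h5 : t ^ α = (t ^ (1 - α)) ^ (α / (1 - α)) := by
        rw [← Real.rpow_mul ht.le]
        congr 1
        field_simp [(by linarith : (1 - α) ≠ 0)]
      rw [h5]
      exact Real.rpow_le_rpow (by positivity) h (div_nonneg hα0.le (by linarith))
    nlinarith

/-- Resolvent bound inside the unit disk for an invertible element whose negative powers grow at
most like `K * exp (D * j ^ α)`. -/
lemma norm_resolvent_le_of_norm_lt_one {a b : A} (hab : a * b = 1) {α D K x : ℝ} (hα0 : 0 < α)
    (hα1 : α < 1) (hD : 0 < D) (hK : 0 ≤ K) (hx : 0 < x) (hx1 : x ≤ 1)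
    (hb : ∀ j : ℕ, 1 ≤ j → ‖b ^ j‖ ≤ K * Real.exp (D * (j : ℝ) ^ α)) {z : ℂ}
    (hz : z ∈ resolventSet ℂ a) (hzx : ‖z‖ = Real.exp (-x)) :
    ‖resolvent a z‖ ≤ K * (8 / x * Real.exp (D * (2 * D / x) ^ (α / (1 - α)))) := by
  set Y := D * (2 * D / x) ^ (α / (1 - α)) with hY
  set q := Real.exp (-(x / 2)) with hq
  have hq0 : 0 < q := Real.exp_pos _
  have hq1 : q < 1 := by rw [hq, Real.exp_lt_one_iff]; linarith
  have hzq : ∀ i : ℕ, ‖z ^ i‖ = Real.exp (-(i * x)) := by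
    intro i
    rw [norm_pow, hzx, ← Real.exp_nat_mul]
    ring_nf
  have hbj : ∀ j : ℕ, 1 ≤ j → ‖b ^ j‖ ≤ K * Real.exp (j * x / 2 + Y) := by
    intro j hj
    refine (hb j hj).trans ?_
    gcongr
    exact mul_rpow_le_linear_add hα0 hα1 hD hx (by exact_mod_cast hj)
  have hterm : ∀ i : ℕ, ‖z ^ i • b ^ (i + 1)‖ ≤ K * Real.exp (Y + x / 2) * q ^ i := by
    intro i
    rw [norm_smul, hzq]
    calc _ ≤ Real.exp (-(i * x)) * (K * Real.exp ((i + 1 : ℕ) * x / 2 + Y)) := by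
          gcongr; exact hbj _ (by omega)
      _ = K * (Real.exp (-(i * x)) * Real.exp ((i + 1 : ℕ) * x / 2 + Y)) := by ring
      _ = K * (Real.exp (Y + x / 2) * q ^ i) := by
          rw [hq, ← Real.exp_nat_mul, ← Real.exp_add, ← Real.exp_add]
          push_cast; ring_nf
      _ = _ := by ring
  have hrem : ∀ n : ℕ, 1 ≤ n →
      ‖z ^ n • (resolvent a z * b ^ n)‖ ≤ K * Real.exp Y * ‖resolvent a z‖ * q ^ n := by
    intro n hn
    rw [norm_smul, hzq]
    calc _ ≤ Real.exp (-(n * x)) * (‖resolvent a z‖ * (K * Real.exp (n * x / 2 + Y))) := by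
          gcongr
          refine (norm_mul_le _ _).trans ?_
          gcongr; exact hbj n hn
      _ = K * ‖resolvent a z‖ * (Real.exp (-(n * x)) * Real.exp (n * x / 2 + Y)) := by ring
      _ = K * ‖resolvent a z‖ * (Real.exp Y * q ^ n) := by
          rw [hq, ← Real.exp_nat_mul, ← Real.exp_add, ← Real.exp_add]
          ring_nf
      _ = _ := by ring
  have hn : ∀ n : ℕ, 1 ≤ n → ‖resolvent a z‖ ≤
      K * Real.exp (Y + x / 2) * (1 - q)⁻¹ + K * Real.exp Y * ‖resolvent a z‖ * q ^ n := by
    intro n hn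
    conv_lhs => rw [resolvent_eq_neg_sum_add hab hz n]
    refine (norm_add_le _ _).trans (add_le_add ?_ (hrem n hn))
    rw [norm_neg]
    refine (norm_sum_le _ _).trans ((Finset.sum_le_sum fun i _ => hterm i).trans ?_)
    rw [← Finset.mul_sum]
    gcongr
    rw [← tsum_geometric_of_lt_one hq0.le hq1]
    exact (summable_geometric_of_lt_one hq0.le hq1).sum_le_tsum _ fun i _ => by positivity
  have hlim : Tendsto (fun n : ℕ => K * Real.exp (Y + x / 2) * (1 - q)⁻¹ +
      K * Real.exp Y * ‖resolvent a z‖ * q ^ n) atTop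
      (nhds (K * Real.exp (Y + x / 2) * (1 - q)⁻¹ + K * Real.exp Y * ‖resolvent a z‖ * 0)) :=
    ((tendsto_pow_atTop_nhds_zero_of_lt_one hq0.le hq1).const_mul _).const_add _
  have hle := ge_of_tendsto hlim (eventually_atTop.2 ⟨1, hn⟩)
  rw [mul_zero, add_zero] at hle
  refine hle.trans ?_
  have hq2 : x / 4 ≤ 1 - q := by
    have h1 : 1 / q = Real.exp (x / 2) := by rw [hq, Real.exp_neg]; simp
    have h2 := Real.add_one_le_exp (x / 2)
    rw [← h1, le_div_iff₀ hq0] at h2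
    nlinarith
  have h2 : Real.exp (x / 2) ≤ 2 := by
    have := Real.exp_one_lt_d9
    have h3 : Real.exp (x / 2) ^ 2 = Real.exp x := by rw [← Real.exp_nat_mul]; ring_nf
    have h4 : Real.exp x ≤ Real.exp 1 := Real.exp_le_exp.2 hx1
    nlinarith [Real.exp_pos (x / 2)]
  have h3 : (1 - q)⁻¹ ≤ (x / 4)⁻¹ := inv_anti₀ (by positivity) hq2
  rw [Real.exp_add, mul_assoc K]
  refine mul_le_mul_of_nonneg_left ?_ hK
  calc Real.exp Y * Real.exp (x / 2) * (1 - q)⁻¹ ≤ Real.exp Y * 2 * (x / 4)⁻¹ := by gcongr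
    _ = 8 / x * Real.exp Y := by field_simp; norm_num

/-- The two-sided resolvent bound near the unit circle in terms of `x = |log ‖z‖|`. -/
lemma norm_resolvent_le {a b : A} (h1 : ‖(1 : A)‖ ≤ 1) (ha : ‖a‖ ≤ 1) (hab : a * b = 1)
    {α β D K : ℝ} (hα0 : 0 < α) (hα1 : α < 1) (hβ : β = α / (1 - α)) (hβ1 : β ≤ 1) (hD : 1 ≤ D)
    (hK : 1 ≤ K) (hb : ∀ j : ℕ, 1 ≤ j → ‖b ^ j‖ ≤ K * Real.exp (D * (j : ℝ) ^ α)) {z : ℂ}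
    (hz : z ∈ resolventSet ℂ a) {t : ℝ} (hzt : ‖z‖ = Real.exp t) (ht0 : t ≠ 0) (ht1 : |t| ≤ 1) :
    ‖resolvent a z‖ ≤ K * Real.exp ((9 + 1 / β) * D ^ (1 + β) * |t| ^ (-β)) := by
  have hβ0 : 0 < β := by rw [hβ]; exact div_pos hα0 (by linarith)
  have hx : 0 < |t| := abs_pos.2 ht0
  have hmain : ‖resolvent a z‖ ≤ K * (8 / |t| * Real.exp (D * (2 * D / |t|) ^ β)) := by
    rcases lt_or_gt_of_ne ht0 with h | h
    · rw [hβ]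
      refine norm_resolvent_le_of_norm_lt_one hab hα0 hα1 (by linarith) (by linarith) hx ht1 hb hz ?_
      rw [hzt, abs_of_neg h, neg_neg]
    · have h2 := Real.add_one_le_exp t
      refine (norm_resolvent_le_of_one_lt_norm h1 ha hz (by rw [hzt]; linarith)).trans ?_
      rw [abs_of_pos h, hzt]
      have h3 : 1 / (Real.exp t - 1) ≤ 8 / t := by
        rw [div_le_div_iff₀ (by linarith) h]; linarith
      have h4 : 1 ≤ Real.exp (D * (2 * D / t) ^ β) := Real.one_le_exp (by positivity)
      have h5 : 0 ≤ 8 / t := by positivity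
      refine h3.trans ?_
      have h6 : 8 / t ≤ 8 / t * Real.exp (D * (2 * D / t) ^ β) := le_mul_of_one_le_right h5 h4
      exact h6.trans (le_mul_of_one_le_left (by positivity) hK)
  refine hmain.trans ?_
  gcongr
  have hy1 : 1 ≤ |t| ^ (-β) := Real.one_le_rpow_of_pos_of_le_one_of_nonpos hx ht1 (by linarith)
  have hD1 : 1 ≤ D ^ (1 + β) := Real.one_le_rpow hD (by linarith)
  have hinv : 1 / |t| ≤ Real.exp (1 / β * |t| ^ (-β)) := by
    have h2 := Real.add_one_le_exp (Real.log (|t| ^ (-β)))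
    rw [Real.exp_log (by positivity), Real.log_rpow hx] at h2
    have h4 : 1 / |t| = Real.exp (-Real.log |t|) := by
      rw [Real.exp_neg, Real.exp_log hx, one_div]
    rw [h4]
    gcongr
    rw [div_mul_eq_mul_div, one_mul, le_div_iff₀ hβ0]
    linarith
  have h8 : (8 : ℝ) ≤ Real.exp (7 * |t| ^ (-β)) := by
    have := Real.add_one_le_exp (7 * |t| ^ (-β)); linarith
  have hpow : D * (2 * D / |t|) ^ β ≤ 2 * (D ^ (1 + β) * |t| ^ (-β)) := by
    rw [Real.div_rpow (by positivity) hx.le, Real.mul_rpow (by norm_num) (by linarith),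
      Real.rpow_neg hx.le, Real.rpow_add (by linarith), Real.rpow_one]
    have h2 : (2 : ℝ) ^ β ≤ 2 := by
      simpa using Real.rpow_le_rpow_of_exponent_le (by norm_num : (1 : ℝ) ≤ 2) hβ1
    calc D * (2 ^ β * D ^ β / |t| ^ β) = 2 ^ β * (D * D ^ β * (|t| ^ β)⁻¹) := by ring
      _ ≤ _ := by gcongr
  calc 8 / |t| * Real.exp (D * (2 * D / |t|) ^ β)
      = 8 * (1 / |t|) * Real.exp (D * (2 * D / |t|) ^ β) := by ring
    _ ≤ Real.exp (7 * |t| ^ (-β)) * Real.exp (1 / β * |t| ^ (-β)) *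
        Real.exp (2 * (D ^ (1 + β) * |t| ^ (-β))) := by gcongr
    _ = Real.exp (7 * |t| ^ (-β) + 1 / β * |t| ^ (-β) + 2 * (D ^ (1 + β) * |t| ^ (-β))) := by
        rw [Real.exp_add, Real.exp_add]
    _ ≤ _ := by
        gcongr
        have h3 : (7 + 1 / β) * |t| ^ (-β) ≤ (7 + 1 / β) * (D ^ (1 + β) * |t| ^ (-β)) := by
          gcongr
          exact le_mul_of_one_le_left (by positivity) hD1
        linarith

end Resolvent

/-- A two-constants type estimate: a holomorphic function on a disk of radius `2 * ρ` bounded by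
`K * exp (C * |re ζ| ^ (-β))` off the imaginary axis, with `0 < β ≤ 1`, is bounded by
`K * exp (8 * C * ρ ^ (-β))` on the real segment of length `2 * ρ`. -/
lemma norm_le_of_norm_le_exp_abs_re {F : Type*} [NormedAddCommGroup F] [NormedSpace ℂ F]
    {f : ℂ → F} {ρ C K β : ℝ} (hρ : 0 < ρ) (hC : 0 < C) (hK : 0 < K) (hβ1 : β ≤ 1)
    (hf : DifferentiableOn ℂ f (ball 0 (2 * ρ)))
    (hb : ∀ ζ ∈ ball (0 : ℂ) (2 * ρ), ζ.re ≠ 0 → ‖f ζ‖ ≤ K * Real.exp (C * |ζ.re| ^ (-β)))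
    {s : ℝ} (hs : |s| < ρ) :
    ‖f s‖ ≤ K * Real.exp (8 * C * ρ ^ (-β)) := by
  obtain ⟨K0, hK0⟩ := (isCompact_closedBall (0 : ℂ) ρ).exists_bound_of_continuousOn
    (hf.continuousOn.mono (closedBall_subset_ball (by linarith)))
  have hK00 : 0 ≤ K0 := (norm_nonneg _).trans (hK0 0 (mem_closedBall_self hρ.le))
  set l := 8 * C * ρ ^ (2 - β) with hl
  have hl0 : 0 < l := by positivity
  set y0 := K0 / K + 1 with hy0
  have hy0p : 0 < y0 := by positivity
  set x0 := l / (8 * ρ * y0) with hx0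
  have hx0p : 0 < x0 := by positivity
  set τ := 2 * ρ * x0 with hτ
  have hτ0 : 0 < τ := by positivity
  let w : ℂ → ℂ := fun ζ => ((ρ ^ 2 + τ : ℝ) : ℂ) + ζ ^ 2
  have hwre : ∀ ζ : ℂ, (w ζ).re = ρ ^ 2 + τ + (ζ.re ^ 2 - ζ.im ^ 2) := by
    intro ζ; simp only [w, add_re, ofReal_re, sq, mul_re]
  have hwim : ∀ ζ : ℂ, (w ζ).im = 2 * ζ.re * ζ.im := by
    intro ζ; simp only [w, add_im, ofReal_im, sq, mul_im]; ring
  let U : Set ℂ := {ζ | |ζ.re| + |ζ.im| < ρ}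
  have hUcl : closure U ⊆ {ζ | |ζ.re| + |ζ.im| ≤ ρ} :=
    closure_lt_subset_le (by fun_prop) continuous_const
  have hUfr : frontier U ⊆ {ζ | |ζ.re| + |ζ.im| = ρ} :=
    frontier_lt_subset_eq (by fun_prop) continuous_const
  have hball : ∀ ζ : ℂ, |ζ.re| + |ζ.im| ≤ ρ → ζ ∈ closedBall (0 : ℂ) ρ := by
    intro ζ h
    rw [mem_closedBall_zero_iff]
    exact (Complex.norm_le_abs_re_add_abs_im ζ).trans h
  have hwpos : ∀ ζ : ℂ, |ζ.re| + |ζ.im| ≤ ρ → 0 < (w ζ).re := by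
    intro ζ h
    rw [hwre]
    have h1 : |ζ.im| ≤ ρ := by linarith [abs_nonneg ζ.re]
    have h2 : ζ.im ^ 2 ≤ ρ ^ 2 := sq_le_sq' (by linarith [neg_abs_le ζ.im]) ((le_abs_self _).trans h1)
    nlinarith [sq_nonneg ζ.re]
  let g : ℂ → F := fun ζ => Complex.exp (-(l / w ζ)) • f ζ
  have hUbdd : Bornology.IsBounded U := by
    refine isBounded_closedBall.subset fun ζ hζ => hball ζ (le_of_lt hζ)
  have hgd : DiffContOnCl ℂ g U := by
    refine DifferentiableOn.diffContOnCl fun ζ hζ => ?_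
    have h1 := hUcl hζ
    have h2 : ζ ∈ ball (0 : ℂ) (2 * ρ) := closedBall_subset_ball (by linarith) (hball ζ h1)
    have h3 : w ζ ≠ 0 := fun h => by have := hwpos ζ h1; rw [h] at this; simp at this
    have h4 : DifferentiableAt ℂ f ζ := hf.differentiableAt (isOpen_ball.mem_nhds h2)
    have h5 : DifferentiableAt ℂ w ζ := by fun_prop
    have h6 : DifferentiableAt ℂ (fun ζ => Complex.exp (-(l / w ζ))) ζ :=
      (((differentiableAt_const _).div h5 h3).neg).cexp
    exact (h6.smul h4).differentiableWithinAt
  have hgn : ∀ ζ, ‖g ζ‖ = Real.exp (-(l / w ζ).re) * ‖f ζ‖ := by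
    intro ζ
    simp only [g, norm_smul, Complex.norm_exp, neg_re]
  have hfr : ∀ ζ ∈ frontier U, ‖g ζ‖ ≤ K := by
    intro ζ hζ
    have h1 : |ζ.re| + |ζ.im| = ρ := hUfr hζ
    have hx : 0 ≤ |ζ.re| := abs_nonneg _
    have hy : 0 ≤ |ζ.im| := abs_nonneg _
    have hre : (w ζ).re = τ + 2 * ρ * |ζ.re| := by
      rw [hwre, ← sq_abs ζ.re, ← sq_abs ζ.im, ← h1]; ring
    have hrep : 0 < (w ζ).re := hwpos ζ h1.le
    have him : (w ζ).im ^ 2 ≤ (w ζ).re ^ 2 := by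
      rw [← sq_abs (w ζ).im, hwim, hre, abs_mul, abs_mul, abs_two]
      gcongr
      nlinarith
    have hrq : l / (2 * (w ζ).re) ≤ (l / w ζ).re := by
      have h2 : (l / w ζ).re = l * (w ζ).re / normSq (w ζ) := by
        rw [Complex.div_re]; simp
      rw [h2, div_le_div_iff₀ (by positivity) (by rw [normSq_apply]; nlinarith), normSq_apply]
      nlinarith
    rw [hgn]
    rcases le_or_gt x0 |ζ.re| with hc | hc
    · have hxp : 0 < |ζ.re| := hx0p.trans_le hc
      have h3 := hb ζ (closedBall_subset_ball (by linarith) (hball ζ h1.le)) (abs_pos.1 hxp)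
      have h4 : (w ζ).re ≤ 4 * ρ * |ζ.re| := by rw [hre, hτ]; nlinarith
      have h5 : C * |ζ.re| ^ (-β) ≤ l / (2 * (w ζ).re) := by
        calc C * |ζ.re| ^ (-β) = C * |ζ.re| ^ (1 - β) / |ζ.re| := by
              rw [Real.rpow_sub hxp, Real.rpow_one, Real.rpow_neg hx]; field_simp
          _ ≤ C * ρ ^ (1 - β) / |ζ.re| := by
              gcongr
              linarith
          _ = l / (2 * (4 * ρ * |ζ.re|)) := by
              rw [hl, show 2 - β = 1 + (1 - β) by ring, Real.rpow_add hρ, Real.rpow_one]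
              field_simp
              norm_num
          _ ≤ _ := by gcongr
      calc _ ≤ Real.exp (-(l / w ζ).re) * (K * Real.exp (C * |ζ.re| ^ (-β))) := by gcongr
        _ = K * Real.exp (-(l / w ζ).re + C * |ζ.re| ^ (-β)) := by rw [Real.exp_add]; ring
        _ ≤ K * 1 := by
            gcongr
            rw [Real.exp_le_one_iff]
            linarith
        _ = K := mul_one K
    · have h4 : (w ζ).re ≤ 4 * ρ * x0 := by rw [hre, hτ]; nlinarith
      have h5 : y0 ≤ l / (2 * (w ζ).re) := by
        calc y0 = l / (2 * (4 * ρ * x0)) := by rw [hx0]; field_simp; norm_num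
          _ ≤ _ := by gcongr
      have h6 := Real.add_one_le_exp (l / w ζ).re
      have h7 : K0 / K ≤ Real.exp (l / w ζ).re := by linarith
      rw [div_le_iff₀ hK] at h7
      rw [Real.exp_neg, inv_mul_le_iff₀ (Real.exp_pos _)]
      exact (hK0 ζ (hball ζ h1.le)).trans h7
  have hsU : (s : ℂ) ∈ U := by simpa [U] using hs
  have hfin := Complex.norm_le_of_forall_mem_frontier_norm_le hUbdd hgd hfr (subset_closure hsU)
  rw [hgn, Real.exp_neg, inv_mul_le_iff₀ (Real.exp_pos _), mul_comm] at hfin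
  refine hfin.trans ?_
  gcongr
  have hws : w s = ((ρ ^ 2 + τ + s ^ 2 : ℝ) : ℂ) := by simp [w]
  rw [hws, ← ofReal_div, ofReal_re]
  calc l / (ρ ^ 2 + τ + s ^ 2) ≤ l / ρ ^ 2 := by
        gcongr; nlinarith [sq_nonneg s]
    _ = 8 * C * ρ ^ (-β) := by
        rw [hl, show 2 - β = 2 + -β by ring, Real.rpow_add hρ, Real.rpow_two]
        field_simp

section Spectrum

variable {A : Type*} [NormedRing A] [NormedAlgebra ℂ A] [CompleteSpace A]

lemma differentiableAt_resolvent {a : A} {z : ℂ} (hz : z ∈ resolventSet ℂ a) :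
    DifferentiableAt ℂ (resolvent a) z :=
  (spectrum.hasDerivAt_resolvent_const_left hz).differentiableAt

/-- Resolvent bound at distance at least `r` from the spectrum. -/
lemma norm_resolvent_le_of_forall_le_dist {a b : A} (h1 : ‖(1 : A)‖ ≤ 1) (ha : ‖a‖ ≤ 1)
    (hab : a * b = 1) {α β D K r : ℝ} (hα0 : 0 < α) (hα1 : α < 1) (hβ : β = α / (1 - α))
    (hβ1 : β ≤ 1) (hD : 1 ≤ D) (hK : 1 ≤ K)
    (hb : ∀ j : ℕ, 1 ≤ j → ‖b ^ j‖ ≤ K * Real.exp (D * (j : ℝ) ^ α)) (hr : 0 < r) (hr1 : r ≤ 1)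
    {z : ℂ} (hz0 : z ≠ 0) (hlog : |Real.log ‖z‖| ≤ 1) (hz : ∀ w ∈ spectrum ℂ a, r ≤ ‖z - w‖) :
    ‖resolvent a z‖ ≤ K * Real.exp (64 * ((9 + 1 / β) * D ^ (1 + β)) * r ^ (-β)) := by
  have hβ0 : 0 < β := by rw [hβ]; exact div_pos hα0 (by linarith)
  set C := (9 + 1 / β) * D ^ (1 + β) with hC
  have hC0 : 0 < C := by positivity
  set s := Real.log ‖z‖ with hs
  have hzs : ‖z‖ = Real.exp s := (Real.exp_log (norm_pos_iff.2 hz0)).symm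
  have hscale : ∀ t : ℝ, 1 ≤ t → (r / t) ^ (-β) ≤ t * r ^ (-β) := by
    intro t ht
    rw [Real.div_rpow hr.le (by linarith), Real.rpow_neg (by linarith : 0 ≤ t), div_inv_eq_mul,
      mul_comm]
    gcongr
    simpa using Real.rpow_le_rpow_of_exponent_le ht hβ1
  have hmem : ∀ z' : ℂ, ‖z' - z‖ < r → z' ∈ resolventSet ℂ a := by
    intro z' h
    by_contra hn
    have h2 := hz z' hn
    rw [norm_sub_rev] at h2
    linarith
  rcases le_or_gt (r / 16) |s| with h | h
  · refine (norm_resolvent_le h1 ha hab hα0 hα1 hβ hβ1 hD hK hb (hmem z (by simpa)) hzs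
      (fun h0 => by rw [h0, abs_zero] at h; linarith) hlog).trans ?_
    gcongr K * Real.exp ?_
    have h2 : |s| ^ (-β) ≤ (r / 16) ^ (-β) :=
      Real.rpow_le_rpow_of_nonpos (by positivity) h (by linarith)
    have h3 := h2.trans (hscale 16 (by norm_num))
    have h4 : 0 < r ^ (-β) := by positivity
    calc C * |s| ^ (-β) ≤ C * (16 * r ^ (-β)) := by gcongr
      _ ≤ 64 * C * r ^ (-β) := by nlinarith [mul_pos hC0 h4]
  · set z1 : ℂ := z / ‖z‖ with hz1
    have hn0 : (‖z‖ : ℂ) ≠ 0 := by exact_mod_cast norm_ne_zero_iff.2 hz0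
    have hz1n : ‖z1‖ = 1 := by rw [hz1, norm_div]; simp [norm_ne_zero_iff.2 hz0]
    have hzz : z = z1 * Complex.exp s := by
      rw [← ofReal_exp, ← hzs, hz1]; field_simp
    have hexp : ∀ ζ : ℂ, ‖ζ‖ ≤ 1 → ‖z1 * Complex.exp ζ - z1‖ ≤ 2 * ‖ζ‖ := by
      intro ζ hζ
      rw [show z1 * Complex.exp ζ - z1 = z1 * (Complex.exp ζ - 1) by ring, norm_mul, hz1n, one_mul]
      exact Complex.norm_exp_sub_one_le hζ
    have hmem2 : ∀ ζ ∈ ball (0 : ℂ) (2 * (r / 8)), z1 * Complex.exp ζ ∈ resolventSet ℂ a := by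
      intro ζ hζ
      rw [mem_ball_zero_iff] at hζ
      refine hmem _ ?_
      have h3 := hexp ζ (by linarith)
      have h4 := hexp s (by rw [norm_real, Real.norm_eq_abs]; linarith)
      rw [← hzz, norm_real, Real.norm_eq_abs] at h4
      have h5 := norm_sub_le (z1 * Complex.exp ζ - z1) (z - z1)
      rw [sub_sub_sub_cancel_right] at h5
      linarith
    have hfin := norm_le_of_norm_le_exp_abs_re (f := fun ζ => resolvent a (z1 * Complex.exp ζ))
      (ρ := r / 8) (C := C) (K := K) (β := β) (s := s) (by positivity) hC0 (by linarith) hβ1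
      (fun ζ hζ => by
        refine DifferentiableAt.differentiableWithinAt ?_
        exact DifferentiableAt.comp (f := fun ζ => z1 * Complex.exp ζ) ζ
          (differentiableAt_resolvent (hmem2 ζ hζ)) (by fun_prop))
      (fun ζ hζ h0 => by
        refine norm_resolvent_le h1 ha hab hα0 hα1 hβ hβ1 hD hK hb (hmem2 ζ hζ) (t := ζ.re) ?_ h0 ?_
        · rw [norm_mul, hz1n, one_mul, Complex.norm_exp]
        · rw [mem_ball_zero_iff] at hζ
          exact (Complex.abs_re_le_norm ζ).trans (by linarith))
      (by linarith)
    rw [← hzz] at hfin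
    refine hfin.trans ?_
    gcongr K * Real.exp ?_
    calc 8 * C * (r / 8) ^ (-β) ≤ 8 * C * (8 * r ^ (-β)) := by
          gcongr; exact hscale 8 (by norm_num)
      _ = _ := by ring

/-- Maximum principle for the resolvent multiplied by a product of singular-inner-type
functions with poles near the points of a finite set `F` covering the spectrum. -/
lemma norm_inverse_le_max {a b : A} (h1 : ‖(1 : A)‖ ≤ 1) (ha : ‖a‖ ≤ 1) (hab : a * b = 1)
    {r M : ℝ} (hr : 0 < r) (hr1 : r ≤ 1 / 8) {F : Finset ℂ} (hF : F.Nonempty)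
    (hFn : ∀ c ∈ F, ‖c‖ = 1) (hsp : ∀ w ∈ spectrum ℂ a, ∃ c ∈ F, ‖w - c‖ ≤ r)
    (hM : ∀ z : ℂ, 3 / 4 ≤ ‖z‖ → ‖z‖ ≤ 5 / 4 → (∀ c ∈ F, 2 * r ≤ ‖z - c‖) →
      ‖resolvent a z‖ ≤ M) :
    ‖b‖ ≤ max (Real.exp 1 / (2 * r)) (Real.exp (1 - 1 / (18 * r * F.card)) * M) := by
  have hN : (0 : ℝ) < F.card := by exact_mod_cast hF.card_pos
  let κ : ℂ → ℂ → ℂ := fun c z => (((1 + 4 * r : ℝ) : ℂ) * c + z) / (((1 + 4 * r : ℝ) : ℂ) * c - z)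
  let G : ℂ → ℂ := fun z => Complex.exp (1 - (F.card : ℂ)⁻¹ * ∑ c ∈ F, κ c z)
  have hPc : ∀ c ∈ F, ‖((1 + 4 * r : ℝ) : ℂ) * c‖ = 1 + 4 * r := by
    intro c hc
    rw [norm_mul, hFn c hc, mul_one, norm_real, Real.norm_of_nonneg (by positivity)]
  have hκre : ∀ c ∈ F, ∀ z, (κ c z).re =
      ((1 + 4 * r) ^ 2 - ‖z‖ ^ 2) / ‖((1 + 4 * r : ℝ) : ℂ) * c - z‖ ^ 2 := by
    intro c hc z
    rw [← normSq_eq_norm_sq, ← normSq_eq_norm_sq,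
      show (1 + 4 * r) ^ 2 = normSq (((1 + 4 * r : ℝ) : ℂ) * c) by
        rw [normSq_eq_norm_sq, hPc c hc]]
    simp only [κ]
    rw [Complex.div_re, ← add_div]
    congr 1
    simp only [normSq_apply, add_re, sub_re, add_im, sub_im]
    ring
  have hne : ∀ c ∈ F, ∀ z : ℂ, ‖z‖ ≤ 1 + 2 * r → ((1 + 4 * r : ℝ) : ℂ) * c - z ≠ 0 := by
    intro c hc z hz h
    rw [sub_eq_zero] at h
    have := hPc c hc
    rw [h] at this
    linarith
  have hκ0 : ∀ c ∈ F, ∀ z : ℂ, ‖z‖ ≤ 1 + 2 * r → 0 ≤ (κ c z).re := by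
    intro c hc z hz
    rw [hκre c hc]
    refine div_nonneg ?_ (by positivity)
    nlinarith [norm_nonneg z]
  have hGn : ∀ z, ‖G z‖ = Real.exp (1 - (F.card : ℝ)⁻¹ * ∑ c ∈ F, (κ c z).re) := by
    intro z
    simp only [G, Complex.norm_exp]
    rw [sub_re, one_re, show ((F.card : ℂ)⁻¹) = (((F.card : ℝ)⁻¹ : ℝ) : ℂ) by push_cast; rfl,
      re_ofReal_mul, re_sum]
  have hG1 : ∀ z : ℂ, ‖z‖ ≤ 1 + 2 * r → ‖G z‖ ≤ Real.exp 1 := by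
    intro z hz
    rw [hGn]
    gcongr
    have : 0 ≤ (F.card : ℝ)⁻¹ * ∑ c ∈ F, (κ c z).re :=
      mul_nonneg (by positivity) (Finset.sum_nonneg fun c hc => hκ0 c hc z hz)
    linarith
  have hG2 : ∀ z : ℂ, ‖z‖ ≤ 1 + 2 * r → ∀ c ∈ F, ‖z - c‖ ≤ 2 * r →
      ‖G z‖ ≤ Real.exp (1 - 1 / (18 * r * F.card)) := by
    intro z hz c hc hzc
    rw [hGn]
    gcongr
    have h2 : 1 / (18 * r) ≤ (κ c z).re := by
      have h3 : ‖((1 + 4 * r : ℝ) : ℂ) * c - z‖ ≤ 6 * r := by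
        have h4 : ((1 + 4 * r : ℝ) : ℂ) * c - z = ((4 * r : ℝ) : ℂ) * c - (z - c) := by
          push_cast; ring
        rw [h4]
        refine (norm_sub_le _ _).trans ?_
        rw [norm_mul, hFn c hc, norm_real, Real.norm_of_nonneg (by positivity)]
        linarith
      have h5 : 0 < ‖((1 + 4 * r : ℝ) : ℂ) * c - z‖ := norm_pos_iff.2 (hne c hc z hz)
      have h6 : ‖((1 + 4 * r : ℝ) : ℂ) * c - z‖ ^ 2 ≤ (6 * r) ^ 2 := by gcongr
      rw [hκre c hc, div_le_div_iff₀ (by positivity) (by positivity)]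
      have h7 : 2 * r ≤ (1 + 4 * r) ^ 2 - ‖z‖ ^ 2 := by nlinarith [norm_nonneg z]
      nlinarith
    have h3 : (κ c z).re ≤ ∑ c ∈ F, (κ c z).re :=
      Finset.single_le_sum (f := fun c => (κ c z).re) (fun c hc => hκ0 c hc z hz) hc
    calc 1 / (18 * r * F.card) = (F.card : ℝ)⁻¹ * (1 / (18 * r)) := by field_simp
      _ ≤ _ := by gcongr; linarith
  let U : Set ℂ := ball 0 (1 + 2 * r) ∩ ⋂ c ∈ F, {z | 2 * r < ‖z - c‖}
  have hUo : IsOpen U := by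
    refine isOpen_ball.inter (isOpen_biInter_finset fun c _ => ?_)
    exact isOpen_lt continuous_const (by fun_prop)
  have hUcl : ∀ z ∈ closure U, ‖z‖ ≤ 1 + 2 * r ∧ ∀ c ∈ F, 2 * r ≤ ‖z - c‖ := by
    have hcl : IsClosed (closedBall (0 : ℂ) (1 + 2 * r) ∩ ⋂ c ∈ F, {z | 2 * r ≤ ‖z - c‖}) := by
      refine isClosed_closedBall.inter (isClosed_biInter fun c _ => ?_)
      exact isClosed_le continuous_const (by fun_prop)
    have hsub : U ⊆ closedBall (0 : ℂ) (1 + 2 * r) ∩ ⋂ c ∈ F, {z | 2 * r ≤ ‖z - c‖} := by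
      refine inter_subset_inter ball_subset_closedBall (iInter₂_mono fun c _ => ?_)
      exact fun z (hz : 2 * r < ‖z - c‖) => hz.le
    intro z hz
    have h2 := closure_minimal hsub hcl hz
    simpa using h2
  have hres : ∀ z : ℂ, (∀ c ∈ F, 2 * r ≤ ‖z - c‖) → z ∈ resolventSet ℂ a := by
    intro z hz
    by_contra hn
    obtain ⟨c, hc, h2⟩ := hsp z hn
    linarith [hz c hc]
  have hd : DiffContOnCl ℂ (fun z => G z • resolvent a z) U := by
    refine DifferentiableOn.diffContOnCl fun z hz => ?_
    obtain ⟨hz1, hz2⟩ := hUcl z hz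
    have hκd : ∀ c ∈ F, DifferentiableAt ℂ (κ c) z := fun c hc =>
      DifferentiableAt.div (by fun_prop) (by fun_prop) (hne c hc z hz1)
    have hGd : DifferentiableAt ℂ G z :=
      ((differentiableAt_const _).sub ((DifferentiableAt.fun_sum hκd).const_mul _)).cexp
    exact (hGd.smul (differentiableAt_resolvent (hres z hz2))).differentiableWithinAt
  have hfr : ∀ z ∈ frontier U, ‖G z • resolvent a z‖ ≤
      max (Real.exp 1 / (2 * r)) (Real.exp (1 - 1 / (18 * r * F.card)) * M) := by
    intro z hz
    obtain ⟨hz1, hz2⟩ := hUcl z (frontier_subset_closure hz)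
    have hzU : z ∉ U := by rw [hUo.frontier_eq] at hz; exact hz.2
    rw [norm_smul]
    rcases lt_or_eq_of_le hz1 with h | h
    · have : ∃ c ∈ F, ‖z - c‖ ≤ 2 * r := by
        by_contra! hcon
        exact hzU ⟨by simpa using h, by simpa using hcon⟩
      obtain ⟨c, hc, hzc⟩ := this
      refine le_max_of_le_right ?_
      have h3 := norm_sub_norm_le c (c - z)
      rw [sub_sub_cancel, hFn c hc, norm_sub_rev] at h3
      exact mul_le_mul (hG2 z hz1 c hc hzc) (hM z (by linarith) (by linarith) hz2)
        (norm_nonneg _) (Real.exp_pos _).le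
    · refine le_max_of_le_left ?_
      have h2 := norm_resolvent_le_of_one_lt_norm h1 ha (hres z hz2) (by linarith)
      rw [h, add_sub_cancel_left] at h2
      calc _ ≤ Real.exp 1 * (1 / (2 * r)) :=
            mul_le_mul (hG1 z hz1) h2 (norm_nonneg _) (Real.exp_pos _).le
        _ = _ := by ring
  have h0U : (0 : ℂ) ∈ U := by
    refine ⟨mem_ball_self (by positivity), ?_⟩
    simp only [mem_iInter, mem_ofPred_eq, zero_sub, norm_neg]
    intro c hc
    rw [hFn c hc]; linarith
  have hbd : Bornology.IsBounded U := isBounded_ball.subset inter_subset_left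
  have hfin := Complex.norm_le_of_forall_mem_frontier_norm_le hbd hd hfr (subset_closure h0U)
  have hG0 : ‖G 0‖ = 1 := by
    rw [hGn]
    have : ∀ c ∈ F, (κ c 0).re = 1 := by
      intro c hc
      rw [hκre c hc, sub_zero, hPc c hc, norm_zero]
      field_simp
      ring
    rw [Finset.sum_congr rfl this]
    simp [hN.ne']
  have hR0 : resolvent a (0 : ℂ) = -b := by
    have h2 := resolvent_mul_algebraMap_sub
      (hres 0 fun c hc => by rw [zero_sub, norm_neg, hFn c hc]; linarith)
    rw [map_zero, zero_sub, mul_neg, neg_eq_iff_eq_neg] at h2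
    calc resolvent a (0 : ℂ) = resolvent a (0 : ℂ) * a * b := by rw [mul_assoc, hab, mul_one]
      _ = -b := by rw [h2, neg_mul, one_mul]
  rwa [norm_smul, hG0, one_mul, hR0, norm_neg] at hfin

end Spectrum

section CantorSet

lemma Eset_digit_sum_summable {ξ : ℝ} (hξ0 : 0 ≤ ξ) (hξ1 : ξ < 1) {ε : ℕ → ℕ}
    (hε : ∀ k, ε k ≤ 1) : Summable fun k => (ε k : ℝ) * ξ ^ k := by
  refine Summable.of_nonneg_of_le (fun k => by positivity) (fun k => ?_)
    (summable_geometric_of_lt_one hξ0 hξ1)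
  exact mul_le_of_le_one_left (by positivity) (by exact_mod_cast hε k)

/-- `E_{1/p}` is invariant under `z ↦ z ^ p`. -/
lemma pow_mem_Eset {p : ℕ} (hp : 2 ≤ p) {z : ℂ} (hz : z ∈ Eset (1 / (p : ℝ))) :
    z ^ p ∈ Eset (1 / (p : ℝ)) := by
  obtain ⟨ε, hε, rfl⟩ := hz
  have hp1 : (1 : ℝ) < p := by exact_mod_cast hp
  have hp0 : (p : ℝ) ≠ 0 := by positivity
  refine ⟨fun k => ε (k + 1), fun k => hε _, ?_⟩
  have hs := Eset_digit_sum_summable (ξ := 1 / (p : ℝ)) (by positivity)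
    (by rw [div_lt_one] <;> linarith) hε
  have hsum : (p : ℝ) * ((1 - 1 / (p : ℝ)) * ∑' k, (ε k : ℝ) * (1 / (p : ℝ)) ^ k) =
      (((p - 1 : ℕ) * ε 0 : ℕ) : ℝ) +
        (1 - 1 / (p : ℝ)) * ∑' k, (ε (k + 1) : ℝ) * (1 / (p : ℝ)) ^ k := by
    rw [hs.tsum_eq_zero_add]
    have h2 : ∑' k, (ε (k + 1) : ℝ) * (1 / (p : ℝ)) ^ (k + 1) =
        1 / (p : ℝ) * ∑' k, (ε (k + 1) : ℝ) * (1 / (p : ℝ)) ^ k := by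
      rw [← tsum_mul_left]
      congr 1; ext k; ring
    rw [h2]
    push_cast [Nat.cast_sub (by omega : 1 ≤ p)]
    field_simp
  rw [← Complex.exp_nat_mul]
  have h3 := congrArg (fun t : ℝ => Complex.exp (2 * Real.pi * Complex.I * (t : ℂ))) hsum
  beta_reduce at h3
  rw [ofReal_mul, ofReal_natCast, ofReal_add, ofReal_natCast, mul_add, Complex.exp_add] at h3
  rw [show 2 * (Real.pi : ℂ) * I * ((((p - 1 : ℕ) * ε 0 : ℕ)) : ℂ) =
    (((p - 1 : ℕ) * ε 0 : ℕ) : ℂ) * (2 * Real.pi * I) by ring,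
    Complex.exp_nat_mul_two_pi_mul_I, one_mul] at h3
  rw [← h3]
  congr 1
  ring

lemma pow_pow_mem_Eset {p : ℕ} (hp : 2 ≤ p) {z : ℂ} (hz : z ∈ Eset (1 / (p : ℝ))) (m : ℕ) :
    z ^ p ^ m ∈ Eset (1 / (p : ℝ)) := by
  induction m with
  | zero => simpa using hz
  | succ m ih => rw [pow_succ, pow_mul]; exact pow_mem_Eset hp ih

/-- `E_ξ` is covered by `2 ^ k` disks of radius `7 * ξ ^ k` centered on the circle. -/
lemma Eset_cover {ξ : ℝ} (hξ0 : 0 ≤ ξ) (hξ1 : ξ < 1) (k : ℕ) :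
    ∃ F : Finset ℂ, F.Nonempty ∧ F.card ≤ 2 ^ k ∧ (∀ c ∈ F, ‖c‖ = 1) ∧
      ∀ z ∈ Eset ξ, ∃ c ∈ F, ‖z - c‖ ≤ 7 * ξ ^ k := by
  let e : ℝ → ℂ := fun t => Complex.exp (2 * Real.pi * Complex.I * (t : ℂ))
  have he : ∀ t, e t = Complex.exp (I * ((2 * Real.pi * t : ℝ) : ℂ)) := by
    intro t; simp only [e]; congr 1; push_cast; ring
  have hen : ∀ t, ‖e t‖ = 1 := by
    intro t; rw [he, mul_comm]; exact Complex.norm_exp_ofReal_mul_I _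
  let c : (Fin k → Fin 2) → ℂ := fun η => e ((1 - ξ) * ∑ l : Fin k, ((η l : ℕ) : ℝ) * ξ ^ (l : ℕ))
  refine ⟨Finset.univ.image c, Finset.univ_nonempty.image c, ?_, ?_, ?_⟩
  · refine Finset.card_image_le.trans ?_
    simp
  · intro w hw
    obtain ⟨η, -, rfl⟩ := Finset.mem_image.1 hw
    exact hen _
  · rintro z ⟨ε, hε, rfl⟩
    refine ⟨c fun l => ⟨ε l, by have := hε l; omega⟩, Finset.mem_image_of_mem _ (Finset.mem_univ _), ?_⟩
    have hs := Eset_digit_sum_summable hξ0 hξ1 hε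
    simp only [c]
    rw [Fin.sum_univ_eq_sum_range (fun l => (ε l : ℝ) * ξ ^ l) k]
    set s := (1 - ξ) * ∑ l ∈ Finset.range k, (ε l : ℝ) * ξ ^ l with hsdef
    set t := (1 - ξ) * ∑' l, (ε l : ℝ) * ξ ^ l with htdef
    have hts : t = s + (1 - ξ) * ∑' l, (ε (l + k) : ℝ) * ξ ^ (l + k) := by
      rw [htdef, hsdef, ← mul_add, hs.sum_add_tsum_nat_add]
    have hd0 : 0 ≤ t - s := by
      rw [hts, add_sub_cancel_left]
      exact mul_nonneg (by linarith) (tsum_nonneg fun l => by positivity)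
    have hd1 : t - s ≤ ξ ^ k := by
      rw [hts, add_sub_cancel_left]
      have h2 : ∑' l, (ε (l + k) : ℝ) * ξ ^ (l + k) ≤ ∑' l, ξ ^ k * ξ ^ l := by
        refine Summable.tsum_le_tsum (fun l => ?_) ((summable_nat_add_iff k).2 hs)
          ((summable_geometric_of_lt_one hξ0 hξ1).mul_left _)
        rw [← pow_add, add_comm l k]
        exact mul_le_of_le_one_left (by positivity) (by exact_mod_cast hε _)
      rw [tsum_mul_left, tsum_geometric_of_lt_one hξ0 hξ1] at h2
      have h3 : 0 < 1 - ξ := by linarith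
      calc _ ≤ (1 - ξ) * (ξ ^ k * (1 - ξ)⁻¹) := by gcongr
        _ = ξ ^ k := by field_simp
    change ‖e t - e s‖ ≤ _
    have h4 : e t - e s = e s * (Complex.exp (I * ((2 * Real.pi * (t - s) : ℝ) : ℂ)) - 1) := by
      rw [mul_sub, mul_one, he, he, ← Complex.exp_add]
      congr 2
      push_cast; ring
    rw [h4, norm_mul, hen, one_mul]
    refine (Real.norm_exp_I_mul_ofReal_sub_one_le).trans ?_
    rw [Real.norm_of_nonneg (by positivity)]
    have := Real.pi_lt_d2
    calc 2 * Real.pi * (t - s) ≤ 7 * ξ ^ k := by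
          have h5 : 2 * Real.pi ≤ 7 := by linarith
          gcongr

end CantorSet

section Contraction

variable {A : Type*} [NormedRing A] [NormedAlgebra ℂ A] [CompleteSpace A]

/-- Bound for the inverse of a contraction with spectrum in `E_{1/p}`, at scale `p ^ (-k)`. -/
lemma norm_inverse_le_of_spectrum_subset_Eset {p : ℕ} (hp : 3 ≤ p) {a b : A}
    (h1 : ‖(1 : A)‖ ≤ 1) (ha : ‖a‖ ≤ 1) (hab : a * b = 1)
    (hsp : spectrum ℂ a ⊆ Eset (1 / (p : ℝ))) {α β D K : ℝ} (hα0 : 0 < α) (hα1 : α < 1)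
    (hβ : β = α / (1 - α)) (hβ1 : β ≤ 1) (hD : 1 ≤ D) (hK : 1 ≤ K)
    (hb : ∀ j : ℕ, 1 ≤ j → ‖b ^ j‖ ≤ K * Real.exp (D * (j : ℝ) ^ α)) {k : ℕ} (hk : 4 ≤ k) :
    ‖b‖ ≤ max ((p : ℝ) ^ k) (K * Real.exp (1 +
      64 * (9 + 1 / β) * D ^ (1 + β) * ((p : ℝ) ^ β) ^ k - ((p : ℝ) / 2) ^ k / 126)) := by
  have hβ0 : 0 < β := by rw [hβ]; exact div_pos hα0 (by linarith)
  have hp3 : (3 : ℝ) ≤ p := by exact_mod_cast hp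
  have hp0 : (0 : ℝ) < p := by linarith
  obtain ⟨F, hF, hFc, hFn, hFs⟩ := Eset_cover (ξ := 1 / (p : ℝ)) (by positivity)
    (by rw [div_lt_one] <;> linarith) k
  have hpk : (81 : ℝ) ≤ (p : ℝ) ^ k := by
    calc (81 : ℝ) = 3 ^ 4 := by norm_num
      _ ≤ (p : ℝ) ^ 4 := by gcongr
      _ ≤ (p : ℝ) ^ k := pow_le_pow_right₀ (by linarith) hk
  set r : ℝ := 7 * (1 / (p : ℝ)) ^ k with hr
  have hr' : r = 7 / (p : ℝ) ^ k := by rw [hr, one_div, inv_pow]; rfl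
  have hr0 : 0 < r := by positivity
  have hr1 : r ≤ 1 / 8 := by
    rw [hr', div_le_div_iff₀ (by positivity) (by norm_num)]; linarith
  have hM := norm_inverse_le_max h1 ha hab hr0 hr1 hF hFn (fun w hw => hFs w (hsp hw))
    (M := K * Real.exp (64 * ((9 + 1 / β) * D ^ (1 + β)) * r ^ (-β)))
    (fun z hz1 hz2 hz3 => by
      have hzp : 0 < ‖z‖ := by linarith
      refine norm_resolvent_le_of_forall_le_dist h1 ha hab hα0 hα1 hβ hβ1 hD hK hb hr0 (by linarith)
        (norm_pos_iff.1 hzp) ?_ fun w hw => ?_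
      · rw [abs_le]
        constructor
        · have h2 := Real.one_sub_inv_le_log_of_pos hzp
          have h3 : ‖z‖⁻¹ ≤ (3 / 4)⁻¹ := inv_anti₀ (by norm_num) hz1
          norm_num at h3
          linarith
        · have h2 := Real.log_le_sub_one_of_pos hzp
          linarith
      · obtain ⟨c, hc, hwc⟩ := hFs w (hsp hw)
        have h2 := hz3 c hc
        have h3 := norm_sub_le_norm_sub_add_norm_sub z w c
        linarith)
  refine hM.trans (max_le_max ?_ ?_)
  · rw [div_le_iff₀ (by positivity), hr']
    have := Real.exp_one_lt_d9
    field_simp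
    linarith
  · rw [mul_left_comm, ← Real.exp_add]
    gcongr K * Real.exp ?_
    have h2 : r ^ (-β) ≤ ((p : ℝ) ^ β) ^ k := by
      have h3 : (1 / (p : ℝ)) ^ k ≤ r := by
        rw [hr]; exact le_mul_of_one_le_left (by positivity) (by norm_num)
      refine (Real.rpow_le_rpow_of_nonpos (by positivity) h3 (by linarith)).trans_eq ?_
      rw [one_div, inv_pow, Real.rpow_neg (by positivity), Real.inv_rpow (by positivity), inv_inv,
        ← Real.rpow_natCast, ← Real.rpow_natCast, ← Real.rpow_mul hp0.le, ← Real.rpow_mul hp0.le,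
        mul_comm]
    have h3 : ((p : ℝ) / 2) ^ k / 126 ≤ 1 / (18 * r * F.card) := by
      have hFc' : (F.card : ℝ) ≤ 2 ^ k := by exact_mod_cast hFc
      have hFp : (0 : ℝ) < F.card := by exact_mod_cast hF.card_pos
      calc ((p : ℝ) / 2) ^ k / 126 = 1 / (18 * r * 2 ^ k) := by
            rw [hr', div_pow]; field_simp; norm_num
        _ ≤ _ := by gcongr
    have h4 : 64 * ((9 + 1 / β) * D ^ (1 + β)) * r ^ (-β) ≤
        64 * (9 + 1 / β) * D ^ (1 + β) * ((p : ℝ) ^ β) ^ k := by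
      rw [← mul_assoc 64]
      gcongr
    linarith

end Contraction

section Bootstrap

variable {A : Type*} [NormedRing A]

lemma norm_pow_le_one {a : A} (h1 : ‖(1 : A)‖ ≤ 1) (ha : ‖a‖ ≤ 1) (n : ℕ) : ‖a ^ n‖ ≤ 1 := by
  induction n with
  | zero => simpa using h1
  | succ n ih =>
    rw [pow_succ]
    exact (norm_mul_le _ _).trans (mul_le_one₀ ih (norm_nonneg _) ha)

/-- The norms of the powers of the inverse of a contraction are nondecreasing. -/
lemma norm_inverse_pow_mono {a b : A} (h1 : ‖(1 : A)‖ ≤ 1) (ha : ‖a‖ ≤ 1) (hab : a * b = 1)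
    {n N : ℕ} (hn : n ≤ N) : ‖b ^ n‖ ≤ ‖b ^ N‖ := by
  obtain ⟨m, rfl⟩ := Nat.exists_eq_add_of_le' hn
  have h2 : b ^ n = a ^ m * b ^ (m + n) := by
    rw [pow_add, ← mul_assoc, pow_mul_pow_eq_one m hab, one_mul]
  rw [h2]
  exact (norm_mul_le _ _).trans
    (mul_le_of_le_one_left (norm_nonneg _) (norm_pow_le_one h1 ha m))

/-- Any power is dominated by a stretched exponential. -/
lemma exists_pow_le_mul_exp_rpow (κ : ℕ) {α : ℝ} (hα : 0 < α) :
    ∃ C : ℝ, 1 ≤ C ∧ ∀ j : ℕ, 1 ≤ j → (j : ℝ) ^ κ ≤ C * Real.exp ((j : ℝ) ^ α) := by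
  set n := ⌈(κ : ℝ) / α⌉₊ with hn
  refine ⟨(n.factorial : ℝ), by exact_mod_cast n.factorial_pos, fun j hj => ?_⟩
  have hj1 : (1 : ℝ) ≤ j := by exact_mod_cast hj
  have h2 := Real.pow_div_factorial_le_exp (x := (j : ℝ) ^ α) (by positivity) n
  rw [div_le_iff₀' (by positivity)] at h2
  refine le_trans ?_ h2
  rw [← Real.rpow_natCast (j : ℝ) κ, ← Real.rpow_natCast _ n, ← Real.rpow_mul (by positivity)]
  refine Real.rpow_le_rpow_of_exponent_le hj1 ?_
  have h3 := Nat.le_ceil ((κ : ℝ) / α)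
  rw [div_le_iff₀' hα] at h3
  exact h3

variable [NormedAlgebra ℂ A] [CompleteSpace A]

lemma norm_inverse_pow_pow_le {p : ℕ} (hp : 3 ≤ p) {a b : A}
    (h1 : ‖(1 : A)‖ ≤ 1) (ha : ‖a‖ ≤ 1) (hab : a * b = 1)
    (hsp : spectrum ℂ a ⊆ Eset (1 / (p : ℝ))) {α β D K : ℝ} (hα0 : 0 < α) (hα1 : α < 1)
    (hβ : β = α / (1 - α)) (hβ1 : β ≤ 1) (hD : 1 ≤ D) (hK : 1 ≤ K) (m : ℕ)
    (hb : ∀ j : ℕ, 1 ≤ j → ‖b ^ (p ^ m * j)‖ ≤ K * Real.exp (D * (j : ℝ) ^ α))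
    {k : ℕ} (hk : 4 ≤ k) :
    ‖b ^ p ^ m‖ ≤ max ((p : ℝ) ^ k) (K * Real.exp (1 +
      64 * (9 + 1 / β) * D ^ (1 + β) * ((p : ℝ) ^ β) ^ k - ((p : ℝ) / 2) ^ k / 126)) := by
  refine norm_inverse_le_of_spectrum_subset_Eset hp h1 (norm_pow_le_one h1 ha (p ^ m))
    (pow_mul_pow_eq_one _ hab) ?_ hα0 hα1 hβ hβ1 hD hK (fun j hj => ?_) hk
  · rw [spectrum.map_pow_of_pos a (by positivity)]
    rintro _ ⟨z, hz, rfl⟩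
    exact pow_pow_mem_Eset (by omega) (hsp hz) m
  · rw [← pow_mul]
    exact hb j hj

/-- A stretched exponential bound on the powers of the inverse yields a polynomial bound. -/
lemma exists_norm_inverse_pow_pow_le_mul_pow {p : ℕ} (hp : 3 ≤ p) {a b : A}
    (h1 : ‖(1 : A)‖ ≤ 1) (ha : ‖a‖ ≤ 1) (hab : a * b = 1)
    (hsp : spectrum ℂ a ⊆ Eset (1 / (p : ℝ))) {α β C : ℝ} (hα0 : 0 < α) (hα1 : α < 1)
    (hβ : β = α / (1 - α)) (hβ1 : β ≤ 1) (hβp : (p : ℝ) ^ β < p / 2) (hC : 1 ≤ C)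
    (hb : ∀ j : ℕ, 1 ≤ j → ‖b ^ j‖ ≤ Real.exp (C * (j : ℝ) ^ α)) :
    ∃ (M : ℝ) (κ : ℕ), ∀ m : ℕ, ‖b ^ p ^ m‖ ≤ M * ((p : ℝ) ^ κ) ^ m := by
  have hβ0 : 0 < β := by rw [hβ]; exact div_pos hα0 (by linarith)
  have hp1 : (1 : ℝ) ≤ p := by exact_mod_cast (by omega : 1 ≤ p)
  have hp0 : (0 : ℝ) < p := by linarith
  set c : ℝ := 64 * (9 + 1 / β) with hc
  have hc0 : 0 < c := by positivity
  have hA1 : 1 ≤ (p : ℝ) ^ β := Real.one_le_rpow hp1 hβ0.le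
  set θ : ℝ := ((p : ℝ) / 2) / (p : ℝ) ^ β with hθ
  have hθ1 : 1 < θ := by rw [hθ, one_lt_div (by positivity)]; exact hβp
  have hθA : θ * (p : ℝ) ^ β = p / 2 := div_mul_cancel₀ _ (by positivity)
  set g : ℝ := ((p : ℝ) ^ α) ^ (1 + β) with hg
  obtain ⟨k₀, hk₀⟩ := pow_unbounded_of_one_lt (126 * (1 + c) * C ^ (1 + β)) hθ1
  obtain ⟨κ, hκ⟩ := pow_unbounded_of_one_lt g hθ1
  refine ⟨(p : ℝ) ^ (k₀ + 4), κ, fun m => ?_⟩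
  set D : ℝ := C * ((p : ℝ) ^ α) ^ m with hD
  have hpα : 1 ≤ (p : ℝ) ^ α := Real.one_le_rpow hp1 hα0.le
  have hD1 : 1 ≤ D := one_le_mul_of_one_le_of_one_le hC (one_le_pow₀ hpα)
  have hDg : D ^ (1 + β) = C ^ (1 + β) * g ^ m := by
    rw [hD, Real.mul_rpow (by positivity) (by positivity), hg,
      Real.rpow_pow_comm (x := (p : ℝ) ^ α) (by positivity)]
  have hk4 : 4 ≤ k₀ + 4 + κ * m := by omega
  have key := norm_inverse_pow_pow_le hp h1 ha hab hsp hα0 hα1 hβ hβ1 hD1 le_rfl m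
    (fun j hj => ?_) hk4
  · rw [← hc] at key
    refine key.trans (max_le ?_ ?_)
    · rw [pow_add, pow_mul]
    · set k := k₀ + 4 + κ * m with hk
      have hD2 : 1 ≤ D ^ (1 + β) := Real.one_le_rpow hD1 (by linarith)
      have hAk : 1 ≤ ((p : ℝ) ^ β) ^ k := one_le_pow₀ hA1
      have hθk : 126 * (1 + c) * D ^ (1 + β) ≤ θ ^ k := by
        calc 126 * (1 + c) * D ^ (1 + β) = 126 * (1 + c) * C ^ (1 + β) * g ^ m := by
              rw [hDg]; ring
          _ ≤ θ ^ k₀ * (θ ^ κ) ^ m := by gcongr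
          _ = θ ^ (k₀ + κ * m) := by rw [pow_add, pow_mul]
          _ ≤ θ ^ k := pow_le_pow_right₀ hθ1.le (by omega)
      have h3 : 126 * (1 + c) * D ^ (1 + β) * ((p : ℝ) ^ β) ^ k ≤ ((p : ℝ) / 2) ^ k := by
        rw [← hθA, mul_pow]
        gcongr
      have h4 := one_le_mul_of_one_le_of_one_le hD2 hAk
      have h5 : 1 + c * D ^ (1 + β) * ((p : ℝ) ^ β) ^ k - ((p : ℝ) / 2) ^ k / 126 ≤ 0 := by
        linarith
      rw [one_mul]
      exact (Real.exp_le_one_iff.2 h5).trans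
        (one_le_mul_of_one_le_of_one_le (one_le_pow₀ hp1) (one_le_pow₀ (one_le_pow₀ hp1)))
  · rw [one_mul]
    refine (hb (p ^ m * j) (Nat.mul_pos (by positivity) hj)).trans_eq ?_
    rw [hD, Real.rpow_pow_comm hp0.le]
    push_cast
    rw [Real.mul_rpow (by positivity) (by positivity), mul_assoc]

/-- A polynomial bound on the powers of the inverse improves to boundedness. -/
lemma exists_norm_inverse_pow_le_of_le_mul_pow {p : ℕ} (hp : 3 ≤ p) {a b : A}
    (h1 : ‖(1 : A)‖ ≤ 1) (ha : ‖a‖ ≤ 1) (hab : a * b = 1)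
    (hsp : spectrum ℂ a ⊆ Eset (1 / (p : ℝ))) {α β M : ℝ} {κ : ℕ} (hα0 : 0 < α) (hα1 : α < 1)
    (hβ : β = α / (1 - α)) (hβ1 : β ≤ 1) (hβp : (p : ℝ) ^ β < p / 2)
    (hb : ∀ m : ℕ, ‖b ^ p ^ m‖ ≤ M * ((p : ℝ) ^ κ) ^ m) :
    ∃ L : ℝ, ∀ n : ℕ, ‖b ^ n‖ ≤ L := by
  have hβ0 : 0 < β := by rw [hβ]; exact div_pos hα0 (by linarith)
  have hp1 : (1 : ℝ) < p := by exact_mod_cast (by omega : 1 < p)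
  have hp0 : (0 : ℝ) < p := by linarith
  set c : ℝ := 64 * (9 + 1 / β) with hc
  obtain ⟨Q, hQ1, hQ⟩ := exists_pow_le_mul_exp_rpow κ hα0
  obtain ⟨k, hk4, hk⟩ : ∃ k : ℕ, 4 ≤ k ∧ (p : ℝ) ^ κ * Q *
      Real.exp (1 + c * (1 : ℝ) ^ (1 + β) * ((p : ℝ) ^ β) ^ k - ((p : ℝ) / 2) ^ k / 126) ≤
        1 / 2 := by
    have hA1 : 1 ≤ (p : ℝ) ^ β := Real.one_le_rpow hp1.le hβ0.le
    have hr : 1 < (p : ℝ) / 2 / (p : ℝ) ^ β := (one_lt_div (by positivity)).2 hβp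
    have hc0 : 0 < c := by positivity
    have hW : 1 ≤ 2 * ((p : ℝ) ^ κ * Q) := by
      linarith [one_le_mul_of_one_le_of_one_le (one_le_pow₀ hp1.le (n := κ)) hQ1]
    set s := Real.log (2 * ((p : ℝ) ^ κ * Q)) with hs
    have hs0 : 0 ≤ s := Real.log_nonneg hW
    obtain ⟨k, hk⟩ := pow_unbounded_of_one_lt (126 * (1 + s + c)) hr
    refine ⟨k + 4, by omega, ?_⟩
    have hk' := hk.le.trans (pow_le_pow_right₀ hr.le (by omega : k ≤ k + 4))
    have hAk : 1 ≤ ((p : ℝ) ^ β) ^ (k + 4) := one_le_pow₀ hA1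
    have h3 : 126 * (1 + s + c) * ((p : ℝ) ^ β) ^ (k + 4) ≤ ((p : ℝ) / 2) ^ (k + 4) := by
      rw [← div_mul_cancel₀ ((p : ℝ) / 2) (by positivity : (p : ℝ) ^ β ≠ 0), mul_pow]
      gcongr
    have h4 := le_mul_of_one_le_right (by linarith : 0 ≤ 1 + s) hAk
    calc _ ≤ (p : ℝ) ^ κ * Q * Real.exp (-s) := by
          rw [Real.one_rpow]
          gcongr
          linarith
      _ = 1 / 2 := by
        rw [hs, Real.exp_neg, Real.exp_log (by linarith)]
        field_simp
  set L := (p : ℝ) ^ k with hL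
  have hL1 : 1 ≤ L := one_le_pow₀ hp1.le
  have hstep : ∀ t m : ℕ, ‖b ^ p ^ m‖ ≤ max L ((1 / 2) ^ t * (M * ((p : ℝ) ^ κ) ^ m)) := by
    intro t
    induction t with
    | zero => intro m; simpa using Or.inr (hb m)
    | succ t ih =>
      intro m
      set R := max L ((1 / 2) ^ t * (M * ((p : ℝ) ^ κ) ^ m)) with hR
      have hR1 : 1 ≤ R := hL1.trans (le_max_left _ _)
      have hpκ : 1 ≤ (p : ℝ) ^ κ := one_le_pow₀ hp1.le
      have hK1 : 1 ≤ R * (p : ℝ) ^ κ * Q :=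
        one_le_mul_of_one_le_of_one_le (one_le_mul_of_one_le_of_one_le hR1 hpκ) hQ1
      have key := norm_inverse_pow_pow_le hp h1 ha hab hsp hα0 hα1 hβ hβ1 le_rfl hK1 m
        (fun j hj => ?_) hk4
      · rw [← hc] at key
        refine key.trans (max_le (le_max_left _ _) ?_)
        calc _ = R * ((p : ℝ) ^ κ * Q * Real.exp (1 + c * (1 : ℝ) ^ (1 + β) *
              ((p : ℝ) ^ β) ^ k - ((p : ℝ) / 2) ^ k / 126)) := by ring
          _ ≤ R * (1 / 2) := by gcongr
          _ ≤ _ := by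
            rw [hR, max_mul_of_nonneg _ _ (by norm_num)]
            refine max_le_max (by linarith) (le_of_eq ?_)
            ring
      · obtain ⟨l, hl1, hl2⟩ : ∃ l : ℕ, j ≤ p ^ l ∧ p ^ l ≤ p * j := by
          refine ⟨Nat.log p j + 1, (Nat.lt_pow_succ_log_self (by omega) j).le, ?_⟩
          rw [pow_succ, mul_comm]
          exact Nat.mul_le_mul_left _ (Nat.pow_log_le_self p (by omega))
        have hl3 : (p : ℝ) ^ l ≤ p * j := by exact_mod_cast hl2
        have hl4 : (1 : ℝ) ≤ ((p : ℝ) ^ l) ^ κ := one_le_pow₀ (one_le_pow₀ hp1.le)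
        rw [one_mul]
        calc ‖b ^ (p ^ m * j)‖ ≤ ‖b ^ p ^ (m + l)‖ := by
              refine norm_inverse_pow_mono h1 ha hab ?_
              rw [pow_add]
              exact Nat.mul_le_mul_left _ hl1
          _ ≤ max L ((1 / 2) ^ t * (M * ((p : ℝ) ^ κ) ^ (m + l))) := ih _
          _ ≤ R * ((p : ℝ) ^ l) ^ κ := by
              rw [hR, max_mul_of_nonneg _ _ (by positivity)]
              refine max_le_max (le_mul_of_one_le_right (by positivity) hl4) (le_of_eq ?_)
              rw [pow_add, pow_right_comm (p : ℝ) l κ]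
              ring
          _ ≤ R * ((p * j : ℝ)) ^ κ := by gcongr
          _ = R * (p : ℝ) ^ κ * (j : ℝ) ^ κ := by rw [mul_pow]; ring
          _ ≤ R * (p : ℝ) ^ κ * (Q * Real.exp ((j : ℝ) ^ α)) := by
              gcongr
              exact hQ j hj
          _ = R * (p : ℝ) ^ κ * Q * Real.exp ((j : ℝ) ^ α) := by ring
  refine ⟨L, fun n => ?_⟩
  have hn : n ≤ p ^ n := (Nat.lt_pow_self (by omega)).le
  refine (norm_inverse_pow_mono h1 ha hab hn).trans ?_
  have hlim : Tendsto (fun t : ℕ => max L ((1 / 2 : ℝ) ^ t * (M * ((p : ℝ) ^ κ) ^ n))) atTop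
      (nhds (max L (0 * (M * ((p : ℝ) ^ κ) ^ n)))) :=
    tendsto_const_nhds.max ((tendsto_pow_atTop_nhds_zero_of_lt_one (by norm_num)
      (by norm_num)).mul_const _)
  have h6 := ge_of_tendsto' hlim fun t => hstep t n
  rwa [zero_mul, max_eq_left (by linarith)] at h6

/-- The inverse of a contraction with spectrum in `E_{1/p}` is power bounded as soon as its
powers grow at most like a stretched exponential of small enough exponent. -/
lemma exists_norm_inverse_pow_le {p : ℕ} (hp : 3 ≤ p) {a b : A}
    (h1 : ‖(1 : A)‖ ≤ 1) (ha : ‖a‖ ≤ 1) (hab : a * b = 1)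
    (hsp : spectrum ℂ a ⊆ Eset (1 / (p : ℝ))) {α C : ℝ} (hα0 : 0 < α)
    (hα : α < (Real.log p - Real.log 2) / (2 * Real.log p - Real.log 2)) (hC : 1 ≤ C)
    (hb : ∀ j : ℕ, 1 ≤ j → ‖b ^ j‖ ≤ Real.exp (C * (j : ℝ) ^ α)) :
    ∃ L : ℝ, ∀ n : ℕ, ‖b ^ n‖ ≤ L := by
  have hp3 : (3 : ℝ) ≤ p := by exact_mod_cast hp
  have hp0 : (0 : ℝ) < p := by linarith
  have hlog2 : 0 < Real.log 2 := Real.log_pos (by norm_num)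
  have hlogp : Real.log 2 < Real.log p := Real.log_lt_log (by norm_num) (by linarith)
  rw [lt_div_iff₀ (by linarith)] at hα
  have hα1 : α < 1 := by
    by_contra! h
    nlinarith
  have hβ : α / (1 - α) * Real.log p < Real.log p - Real.log 2 := by
    rw [div_mul_eq_mul_div, div_lt_iff₀ (by linarith)]
    linarith
  have hβ1 : α / (1 - α) ≤ 1 := by
    by_contra! h
    nlinarith
  have hβp : (p : ℝ) ^ (α / (1 - α)) < p / 2 := by
    rw [← Real.log_lt_log_iff (by positivity) (by positivity), Real.log_rpow hp0,
      Real.log_div (by positivity) (by norm_num)]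
    exact hβ
  obtain ⟨M, κ, hMκ⟩ := exists_norm_inverse_pow_pow_le_mul_pow hp h1 ha hab hsp hα0 hα1 rfl
    hβ1 hβp hC hb
  exact exists_norm_inverse_pow_le_of_le_mul_pow hp h1 ha hab hsp hα0 hα1 rfl hβ1 hβp hMκ

end Bootstrap

/-- Let `p ≥ 3` and let `T` be an invertible contraction on a Banach space
with `Sp T ⊆ E_{1/p}`. If `limsup (log⁺ ‖T^{-n}‖)/n^α < ∞` for some
`α < (log p - log 2)/(2 log p - log 2)`, then `sup_{n ≥ 1} ‖T^{-n}‖ < ∞`. -/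
theorem stmt_15 (p : ℕ) (hp : 3 ≤ p)
    {X : Type} [NormedAddCommGroup X] [NormedSpace ℂ X] [CompleteSpace X]
    (T Tinv : X →L[ℂ] X) (hT : ‖T‖ ≤ 1) (h1 : T * Tinv = 1) (h2 : Tinv * T = 1)
    (hsp : spectrum ℂ T ⊆ Eset (1 / (p : ℝ)))
    (α : ℝ) (hα : α < (Real.log p - Real.log 2) / (2 * Real.log p - Real.log 2))
    (hbd : ∃ C : ℝ, ∀ n : ℕ, 1 ≤ n →
      max (Real.log ‖Tinv ^ n‖) 0 ≤ C * (n : ℝ) ^ α) :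
    ∃ M : ℝ, ∀ n : ℕ, 1 ≤ n → ‖Tinv ^ n‖ ≤ M := by
  obtain ⟨C, hC⟩ := hbd
  have hp3 : (3 : ℝ) ≤ p := by exact_mod_cast hp
  have hlog2 : 0 < Real.log 2 := Real.log_pos (by norm_num)
  have hlogp : Real.log 2 < Real.log p := Real.log_lt_log (by norm_num) (by linarith)
  have hpos : 0 < (Real.log p - Real.log 2) / (2 * Real.log p - Real.log 2) :=
    div_pos (by linarith) (by linarith)
  obtain ⟨α', hα', hα'1⟩ := exists_between (max_lt hα hpos)
  obtain ⟨hαα', hα'0⟩ := max_lt_iff.1 hα'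
  obtain ⟨L, hL⟩ : ∃ L : ℝ, ∀ n : ℕ, ‖Tinv ^ n‖ ≤ L := by
    refine exists_norm_inverse_pow_le hp ContinuousLinearMap.norm_id_le hT h1 hsp hα'0
      hα'1 (le_max_right C 1) fun j hj => ?_
    have hj1 : (1 : ℝ) ≤ j := by exact_mod_cast hj
    refine (Real.le_exp_log _).trans (Real.exp_le_exp.2 ?_)
    calc Real.log ‖Tinv ^ j‖ ≤ C * (j : ℝ) ^ α := (le_max_left _ _).trans (hC j hj)
      _ ≤ max C 1 * (j : ℝ) ^ α := by
        gcongr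
        exact le_max_left _ _
      _ ≤ max C 1 * (j : ℝ) ^ α' := by gcongr
  exact ⟨L, fun n _ => hL n⟩
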